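/- Let M⋆ be a rank-r real symmetric n×n matrix with nonzero eigenvalues satisfying 1 = |λ₁⋆| ≥ ⋯ ≥ |λ_r⋆| = λ_min⋆ > 0, set κ = 1/λ_min⋆, and let H satisfy ‖H‖ ≤ 1/(4κ). Then for each of the top-r unit eigenvectors u_l of M = M⋆ + H (1 ≤ l ≤ r), one has Σ_{j=1}^r |u_j⋆ᵀ u_l|² ≥ 1 − (64 κ⁴ / 9) ‖H‖². -/

import Mathlib

open Matrix
open scoped Classical

/-- Spectral (operator 2-) norm of a real square matrix. -/
noncomputable def spNormR {n : ℕ} (A : Matrix (Fin n) (Fin n) ℝ) : ℝ :=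
  ‖LinearMap.toContinuousLinearMap (Matrix.toEuclideanLin A)‖


lemma aux_geom {V : Type*} [NormedAddCommGroup V] [NormedSpace ℂ V] (T : Module.End ℂ V)
    (c : ℝ) (mu : ℂ) (hmu : ‖mu‖ < c) (k : ℕ) : ∀ x : V, ((T - algebraMap ℂ _ mu) ^ k) x = 0 →
    ∃ C : ℝ, ∀ m : ℕ, ‖(T ^ m) x‖ ≤ C * c ^ m := by
  have hc : 0 < c := (norm_nonneg _).trans_lt hmu
  induction k with
  | zero =>
    intro x hx
    have : x = 0 := by simpa using hx
    exact ⟨0, fun m => by simp [this]⟩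
  | succ k ih =>
    intro x hx
    rw [pow_succ, Module.End.mul_apply] at hx
    obtain ⟨B, hB⟩ := ih _ hx
    refine ⟨max ‖x‖ (B / (c - ‖mu‖)), fun m => ?_⟩
    induction m with
    | zero => simp
    | succ m ihm =>
      have e : (T ^ (m+1)) x = mu • (T ^ m) x + (T ^ m) ((T - algebraMap ℂ _ mu) x) := by
        rw [pow_succ, Module.End.mul_apply]
        simp [Module.algebraMap_end_apply]
      have h1 := hB m
      have h2 : B ≤ max ‖x‖ (B / (c - ‖mu‖)) * (c - ‖mu‖) := by
        rw [← div_le_iff₀ (by linarith)]; exact le_max_right _ _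
      have h3 := norm_add_le (mu • (T ^ m) x) ((T ^ m) ((T - algebraMap ℂ _ mu) x))
      rw [norm_smul] at h3
      rw [e]
      set A := max ‖x‖ (B / (c - ‖mu‖))
      have h4 : ‖mu‖ * ‖(T^m) x‖ ≤ ‖mu‖ * (A * c ^ m) := by gcongr
      have h5 : B * c ^ m ≤ A * (c - ‖mu‖) * c ^ m := by gcongr
      rw [pow_succ]
      nlinarith

def slowSub {V : Type*} [NormedAddCommGroup V] [NormedSpace ℂ V] (T : Module.End ℂ V)
    (c : ℝ) : Submodule ℂ V where
  carrier := {x | ∃ C : ℝ, ∀ m : ℕ, ‖(T ^ m) x‖ ≤ C * c ^ m}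
  zero_mem' := ⟨0, fun m => by simp⟩
  add_mem' := by
    rintro x y ⟨C, hC⟩ ⟨D, hD⟩
    refine ⟨C + D, fun m => ?_⟩
    rw [map_add, add_mul]
    exact (norm_add_le _ _).trans (add_le_add (hC m) (hD m))
  smul_mem' := by
    rintro a x ⟨C, hC⟩
    refine ⟨‖a‖ * C, fun m => ?_⟩
    rw [map_smul, norm_smul, mul_assoc]
    exact mul_le_mul_of_nonneg_left (hC m) (norm_nonneg _)

lemma finrank_sup_indep {V ι : Type*} [AddCommGroup V] [Module ℂ V] [FiniteDimensional ℂ V]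
    (f : ι → Submodule ℂ V) (hf : iSupIndep f) (s : Finset ι) :
    ∑ i ∈ s, Module.finrank ℂ (f i) ≤ Module.finrank ℂ (s.sup f : Submodule ℂ V) := by
  induction s using Finset.induction_on with
  | empty => simp
  | insert a s ha ih =>
    rw [Finset.sum_insert ha, Finset.sup_insert]
    have h := Submodule.finrank_sup_add_finrank_inf_eq (f a) (s.sup f)
    have hd : Disjoint (f a) (s.sup f) := by
      refine (hf a).mono_right ?_
      refine Finset.sup_le fun i hi => ?_
      exact le_iSup₂_of_le i (fun h => ha (h ▸ hi)) le_rfl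
    rw [hd.eq_bot, finrank_bot] at h
    omega

lemma finrank_slow {V : Type*} [NormedAddCommGroup V] [NormedSpace ℂ V] [FiniteDimensional ℂ V]
    (T : Module.End ℂ V) (c a : ℝ) (hac : a < c) :
    Module.finrank ℂ V ≤ Module.finrank ℂ (slowSub T c) +
      (T.charpoly.roots.filter (fun mu => a < ‖mu‖)).card := by
  set R := T.charpoly.roots with hR
  have hn : R.card = Module.finrank ℂ V := by
    rw [hR, ← (IsAlgClosed.splits T.charpoly).natDegree_eq_card_roots, LinearMap.charpoly_natDegree]
  have h1 : (R.filter (fun mu => a < ‖mu‖)).card + (R.filter (fun mu => ¬ a < ‖mu‖)).card = R.card := by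
    rw [← Multiset.card_add, Multiset.filter_add_not]
  have h2 : (R.filter (fun mu => ¬ a < ‖mu‖)).card
      ≤ Module.finrank ℂ (slowSub T c) := by
    set Q := R.filter (fun mu => ¬ a < ‖mu‖) with hQ
    calc Q.card = ∑ mu ∈ Q.toFinset, Q.count mu := (Multiset.toFinset_sum_count_eq Q).symm
      _ ≤ ∑ mu ∈ Q.toFinset, Module.finrank ℂ (T.maxGenEigenspace mu) := by
        refine Finset.sum_le_sum fun mu _ => ?_
        rw [LinearMap.finrank_maxGenEigenspace_eq, ← Polynomial.count_roots]
        exact Multiset.count_le_of_le _ (Multiset.filter_le _ _)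
      _ ≤ Module.finrank ℂ (Q.toFinset.sup T.maxGenEigenspace : Submodule ℂ V) :=
        finrank_sup_indep _ T.independent_maxGenEigenspace _
      _ ≤ _ := by
        apply Submodule.finrank_mono
        refine Finset.sup_le fun mu hmu x hx => ?_
        rw [Multiset.mem_toFinset, hQ, Multiset.mem_filter] at hmu
        rw [Module.End.mem_maxGenEigenspace] at hx
        obtain ⟨k, hk⟩ := hx
        exact aux_geom T c mu (by linarith [not_lt.1 hmu.2]) k x hk
  omega

section
variable {V : Type*} [NormedAddCommGroup V] [InnerProductSpace ℂ V] {r : ℕ}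

noncomputable def prj (v : Fin r → V) (x : V) : V := ∑ j, (inner ℂ (v j) x) • v j

lemma prj_normsq {v : Fin r → V} (hv : Orthonormal ℂ v) (l : Fin r → ℂ) :
    ‖∑ j, l j • v j‖ ^ 2 = ∑ j, ‖l j‖ ^ 2 := by
  have := hv.inner_sum l l Finset.univ
  rw [inner_self_eq_norm_sq_to_K] at this
  simp only [← starRingEnd_apply, RCLike.conj_mul] at this
  exact_mod_cast this

lemma prj_sum {v : Fin r → V} (hv : Orthonormal ℂ v) (l : Fin r → ℂ) :
    prj v (∑ j, l j • v j) = ∑ j, l j • v j := by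
  simp [prj, hv.inner_right_fintype]

lemma prj_add (v : Fin r → V) (x y : V) : prj v (x + y) = prj v x + prj v y := by
  simp [prj, inner_add_right, add_smul, Finset.sum_add_distrib]

lemma prj_smul (v : Fin r → V) (a : ℂ) (x : V) : prj v (a • x) = a • prj v x := by
  simp [prj, inner_smul_right, mul_smul, Finset.smul_sum]

lemma prj_pyth {v : Fin r → V} (hv : Orthonormal ℂ v) (x : V) :
    ‖x‖ ^ 2 = ‖prj v x‖ ^ 2 + ‖x - prj v x‖ ^ 2 := by
  have h : inner ℂ (prj v x) (x - prj v x) = 0 := by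
    conv_lhs => arg 2; rw [prj]
    rw [sum_inner]
    refine Finset.sum_eq_zero fun j _ => ?_
    rw [inner_smul_left, inner_sub_right, prj, hv.inner_right_fintype, sub_self, mul_zero]
  have := norm_add_sq_eq_norm_sq_add_norm_sq_of_inner_eq_zero _ _ h
  rw [add_sub_cancel] at this
  nlinarith

lemma prj_le {v : Fin r → V} (hv : Orthonormal ℂ v) (x : V) : ‖prj v x‖ ≤ ‖x‖ := by
  have := prj_pyth hv x
  exact le_of_sq_le_sq (by nlinarith [sq_nonneg ‖x - prj v x‖]) (norm_nonneg _)

lemma prj_le' {v : Fin r → V} (hv : Orthonormal ℂ v) (x : V) : ‖x - prj v x‖ ≤ ‖x‖ := by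
  have := prj_pyth hv x
  exact le_of_sq_le_sq (by nlinarith [sq_nonneg ‖prj v x‖]) (norm_nonneg _)

lemma abs_main [FiniteDimensional ℂ V] {v : Fin r → V} (hv : Orthonormal ℂ v) (ls : Fin r → ℂ)
    (L : ℝ) (hL : 0 < L) (hls : ∀ j, L ≤ ‖ls j‖) (T h : Module.End ℂ V) (ε : ℝ)
    (hε : 4 * ε ≤ L) (hh : ∀ x, ‖h x‖ ≤ ε * ‖x‖)
    (hT : ∀ x, T x = ∑ j, (ls j * inner ℂ (v j) x) • v j + h x)
    (lam : ℂ) (htop : (T.charpoly.roots.filter (fun mu => ‖lam‖ < ‖mu‖)).card < r)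
    (x : V) (hx : ‖x‖ = 1) (heig : T x = lam • x) :
    3 / 8 * L ≤ ‖lam‖ ∧ ‖lam‖ * ‖x - prj v x‖ ≤ ε := by
  have hPT : ∀ x, prj v (T x) = ∑ j, (ls j * inner ℂ (v j) x) • v j + prj v (h x) := by
    intro x; rw [hT, prj_add, prj_sum hv]
  have hQT : ∀ x, T x - prj v (T x) = h x - prj v (h x) := by
    intro x; rw [hPT, hT]; abel
  constructor
  · by_contra hcon
    push Not at hcon
    have hfr := finrank_slow T (3/8*L) ‖lam‖ hcon
    have hspan : Module.finrank ℂ (Submodule.span ℂ (Set.range v)) = r := by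
      rw [finrank_span_eq_card hv.linearIndependent, Fintype.card_fin]
    have hnd : ¬ Disjoint (slowSub T (3/8*L)) (Submodule.span ℂ (Set.range v)) := by
      intro hd
      have := Submodule.finrank_add_finrank_le_of_disjoint hd
      omega
    rw [Submodule.disjoint_def] at hnd
    push Not at hnd
    obtain ⟨y, ⟨C, hC⟩, hy, hy0⟩ := hnd
    have hPy : prj v y = y := by
      obtain ⟨l, rfl⟩ := (Submodule.mem_span_range_iff_exists_fun ℂ).1 hy
      exact prj_sum hv l
    have hstep : ∀ z, ‖z - prj v z‖ ≤ ‖prj v z‖ →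
        ‖T z - prj v (T z)‖ ≤ ‖prj v (T z)‖ ∧ L / 2 * ‖prj v z‖ ≤ ‖prj v (T z)‖ := by
      intro z hz
      have h1 : ‖z‖ ≤ 2 * ‖prj v z‖ := by
        have := norm_add_le (prj v z) (z - prj v z)
        rw [add_sub_cancel] at this
        linarith
      have h2 : ‖h z‖ ≤ L / 2 * ‖prj v z‖ := by
        have := hh z
        have : ε * ‖z‖ ≤ L / 4 * ‖z‖ := by gcongr; linarith
        nlinarith
      have h3 : L * ‖prj v z‖ ≤ ‖∑ j, (ls j * inner ℂ (v j) z) • v j‖ := by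
        apply le_of_sq_le_sq _ (norm_nonneg _)
        rw [mul_pow, prj_normsq hv, prj, prj_normsq hv, Finset.mul_sum]
        refine Finset.sum_le_sum fun j _ => ?_
        rw [norm_mul, mul_pow]
        have := hls j
        gcongr
      have h4 : L / 2 * ‖prj v z‖ ≤ ‖prj v (T z)‖ := by
        have h5 := norm_sub_le (prj v (T z)) (prj v (h z))
        rw [hPT, add_sub_cancel_right] at h5
        rw [hPT]
        linarith [prj_le hv (h z)]
      refine ⟨?_, h4⟩
      rw [hQT]
      linarith [prj_le' hv (h z)]
    have hgrow : ∀ m : ℕ, ‖(T^m) y - prj v ((T^m) y)‖ ≤ ‖prj v ((T^m) y)‖ ∧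
        (L/2)^m * ‖y‖ ≤ ‖prj v ((T^m) y)‖ := by
      intro m
      induction m with
      | zero => simp [hPy]
      | succ m ih =>
        rw [pow_succ' T, Module.End.mul_apply]
        obtain ⟨a, b⟩ := hstep _ ih.1
        refine ⟨a, le_trans ?_ b⟩
        rw [pow_succ', mul_assoc]
        have := ih.2
        gcongr
    have hyp : 0 < ‖y‖ := norm_pos_iff.2 hy0
    have hbd : ∀ m : ℕ, (4/3 : ℝ)^m * ‖y‖ ≤ C := by
      intro m
      have h1 := ((hgrow m).2.trans (prj_le hv _)).trans (hC m)
      have h2 : (L/2)^m = (4/3:ℝ)^m * (3/8*L)^m := by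
        rw [← mul_pow]; congr 1; ring
      rw [h2] at h1
      have h3 : 0 < (3/8*L)^m := by positivity
      exact le_of_mul_le_mul_right (by linarith) h3
    obtain ⟨m, hm⟩ := pow_unbounded_of_one_lt (C/‖y‖) (by norm_num : (1:ℝ) < 4/3)
    rw [div_lt_iff₀ hyp] at hm
    linarith [hbd m]
  · have := hQT x
    rw [heig, prj_smul, ← smul_sub] at this
    rw [← norm_smul, this]
    refine (prj_le' hv _).trans ?_
    simpa [hx] using hh x
end

lemma complex_op_bound {n : ℕ} (H : Matrix (Fin n) (Fin n) ℝ) (x : EuclideanSpace ℂ (Fin n)) :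
    ‖Matrix.toEuclideanLin (H.map (algebraMap ℝ ℂ)) x‖ ≤
      ‖LinearMap.toContinuousLinearMap (Matrix.toEuclideanLin H)‖ * ‖x‖ := by
  set N := ‖LinearMap.toContinuousLinearMap (Matrix.toEuclideanLin H)‖ with hN
  have hN0 : 0 ≤ N := norm_nonneg _
  have key : ∀ y : Fin n → ℝ, ∑ i, (H.mulVec y i) ^ 2 ≤ N ^ 2 * ∑ i, (y i) ^ 2 := by
    intro y
    have h := (LinearMap.toContinuousLinearMap (Matrix.toEuclideanLin H)).le_opNorm
      (WithLp.toLp 2 y)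
    rw [← hN] at h
    have h2 := pow_le_pow_left₀ (norm_nonneg _) h 2
    rw [mul_pow, EuclideanSpace.norm_sq_eq, EuclideanSpace.norm_sq_eq] at h2
    simpa [Matrix.toLpLin_apply] using h2
  have hsq : ∀ z : ℂ, ‖z‖ ^ 2 = z.re ^ 2 + z.im ^ 2 := by
    intro z; rw [Complex.sq_norm, Complex.normSq_apply]; ring
  apply le_of_sq_le_sq _ (by positivity)
  rw [mul_pow, EuclideanSpace.norm_sq_eq, EuclideanSpace.norm_sq_eq]
  have h1 := key (fun i => (x i).re)
  have h2 := key (fun i => (x i).im)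
  simp only [hsq, Finset.sum_add_distrib, mul_add]
  refine le_trans (le_of_eq ?_) (add_le_add h1 h2)
  congr 1
  · refine Finset.sum_congr rfl fun i _ => ?_
    simp [Matrix.toLpLin_apply, Matrix.mulVec, dotProduct]
  · refine Finset.sum_congr rfl fun i _ => ?_
    simp [Matrix.toLpLin_apply, Matrix.mulVec, dotProduct]

/-- For a rank-`r` symmetric truth with eigenvalues `1 = |λ₁⋆| ≥ ⋯ ≥ |λ_r⋆| = λ_min⋆ > 0`,
`κ = 1/λ_min⋆` and `‖H‖ ≤ 1/(4κ)`, every unit eigenvector `u_l` of `M = M⋆ + H`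
associated with one of its `r` largest-modulus eigenvalues satisfies
`Σ_j |u_j⋆ᵀ u_l|² ≥ 1 − (64 κ⁴/9) ‖H‖²`. -/
theorem rank_r_eigenvector_alignment {n r : ℕ} (hr : 0 < r)
    (u : Fin r → (Fin n → ℝ)) (lamstar : Fin r → ℝ)
    (horth : ∀ i j, u i ⬝ᵥ u j = if i = j then (1 : ℝ) else 0)
    (hsort : ∀ i j : Fin r, i ≤ j → |lamstar j| ≤ |lamstar i|)
    (hmax : |lamstar ⟨0, hr⟩| = 1)
    (lammin : ℝ) (hmin : |lamstar ⟨r - 1, Nat.sub_lt hr one_pos⟩| = lammin)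
    (hminpos : 0 < lammin)
    (κ : ℝ) (hκ : κ = 1 / lammin)
    (Mstar : Matrix (Fin n) (Fin n) ℝ)
    (hMstar : Mstar = ∑ j, lamstar j • Matrix.vecMulVec (u j) (u j))
    (H : Matrix (Fin n) (Fin n) ℝ) (hH : spNormR H ≤ 1 / (4 * κ))
    (M : Matrix (Fin n) (Fin n) ℝ) (hM : M = Mstar + H)
    (lam : ℂ)
    (hroot : lam ∈ ((M.map (algebraMap ℝ ℂ)).charpoly).roots)
    -- `lam` is among the `r` eigenvalues of `M` of largest modulus:
    (htop : (((M.map (algebraMap ℝ ℂ)).charpoly).roots.filter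
        (fun μ => ‖lam‖ < ‖μ‖)).card < r)
    (ul : Fin n → ℂ) (hunit : ∑ i, ‖ul i‖ ^ 2 = 1)
    (heig : (M.map (algebraMap ℝ ℂ)).mulVec ul = lam • ul) :
    1 - (64 * κ ^ 4 / 9) * spNormR H ^ 2
      ≤ ∑ j : Fin r, ‖(fun i => (u j i : ℂ)) ⬝ᵥ ul‖ ^ 2 := by
  set v : Fin r → EuclideanSpace ℂ (Fin n) := fun j => WithLp.toLp 2 (fun i => (u j i : ℂ)) with hvdef
  have hin : ∀ j (x : EuclideanSpace ℂ (Fin n)),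
      inner ℂ (v j) x = (fun i => (u j i : ℂ)) ⬝ᵥ x.ofLp := by
    intro j x
    simp [hvdef, PiLp.inner_apply, dotProduct, mul_comm]
  have hv : Orthonormal ℂ v := by
    rw [orthonormal_iff_ite]
    intro i j
    rw [hin]
    have := congrArg (fun t : ℝ => (t : ℂ)) (horth i j)
    simp only [dotProduct, Complex.ofReal_sum, Complex.ofReal_mul] at this
    simp only [hvdef, dotProduct]
    rw [this]
    split_ifs <;> simp
  have hls : ∀ j, lammin ≤ ‖((lamstar j : ℝ) : ℂ)‖ := by
    intro j
    rw [Complex.norm_real, Real.norm_eq_abs, ← hmin]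
    apply hsort
    rw [Fin.le_def]
    have := j.2
    simp only
    omega
  have hL1 : lammin ≤ 1 := by
    rw [← hmin, ← hmax]
    apply hsort
    rw [Fin.le_def]
    simp
  have hε : 4 * spNormR H ≤ lammin := by
    have : 1 / (4 * κ) = lammin / 4 := by rw [hκ]; field_simp
    rw [this] at hH
    linarith
  set T : Module.End ℂ (EuclideanSpace ℂ (Fin n)) :=
    Matrix.toEuclideanLin (M.map (algebraMap ℝ ℂ)) with hTdef
  have hchar : T.charpoly = (M.map (algebraMap ℝ ℂ)).charpoly := by
    rw [hTdef, Matrix.toEuclideanLin_eq_toLin_orthonormal]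
    exact Matrix.charpoly_toLin _ _
  have hT : ∀ x, T x = ∑ j, (((lamstar j : ℝ) : ℂ) * inner ℂ (v j) x) • v j
      + Matrix.toEuclideanLin (H.map (algebraMap ℝ ℂ)) x := by
    intro x
    ext i
    simp only [hin]
    simp only [hTdef, hM, hMstar, hvdef, Matrix.toLpLin_apply, Matrix.mulVec, dotProduct,
      PiLp.add_apply, WithLp.ofLp_sum, Finset.sum_apply, PiLp.smul_apply, WithLp.ofLp_smul,
      Pi.smul_apply, smul_eq_mul, Matrix.map_apply, Matrix.add_apply, Matrix.sum_apply,
      Matrix.smul_apply, Matrix.vecMulVec_apply, Complex.ofReal_add, Complex.ofReal_sum, Complex.ofReal_mul, add_mul,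
      Finset.sum_add_distrib, Complex.coe_algebraMap, Finset.sum_mul, Finset.mul_sum]
    congr 1
    rw [Finset.sum_comm]
    refine Finset.sum_congr rfl fun j _ => Finset.sum_congr rfl fun k _ => ?_
    ring
  have hxn : ‖(WithLp.toLp 2 ul : EuclideanSpace ℂ (Fin n))‖ = 1 := by
    have : ‖(WithLp.toLp 2 ul : EuclideanSpace ℂ (Fin n))‖ ^ 2 = 1 := by
      rw [EuclideanSpace.norm_sq_eq]; exact hunit
    nlinarith [norm_nonneg (WithLp.toLp 2 ul : EuclideanSpace ℂ (Fin n))]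
  obtain ⟨hlam, hfin⟩ := abs_main hv (fun j => ((lamstar j : ℝ) : ℂ)) lammin hminpos hls T
    (Matrix.toEuclideanLin (H.map (algebraMap ℝ ℂ))) (spNormR H) hε
    (fun x => complex_op_bound H x) hT lam (by rw [hchar]; convert htop)
    (WithLp.toLp 2 ul) hxn (by
      rw [hTdef, Matrix.toLpLin_apply, heig]; rfl)
  have hp := prj_pyth hv (WithLp.toLp 2 ul)
  rw [hxn] at hp
  have hps : ‖prj v (WithLp.toLp 2 ul)‖ ^ 2 = ∑ j : Fin r, ‖(fun i => (u j i : ℂ)) ⬝ᵥ ul‖ ^ 2 := by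
    rw [prj, prj_normsq hv]
    simp only [hin]
  rw [← hps]
  set q := ‖(WithLp.toLp 2 ul : EuclideanSpace ℂ (Fin n)) - prj v (WithLp.toLp 2 ul)‖ with hq
  have hq0 : 0 ≤ q := norm_nonneg _
  have h1 : 3 / 8 * lammin * q ≤ spNormR H := by
    refine le_trans ?_ hfin
    gcongr
  have hκ1 : κ * lammin = 1 := by rw [hκ]; field_simp
  have hκp : 1 ≤ κ := by rw [hκ, le_div_iff₀ hminpos]; linarith
  have h2 : q ≤ 8 / 3 * κ * spNormR H := by
    have := mul_le_mul_of_nonneg_left h1 (by positivity : (0:ℝ) ≤ 8 / 3 * κ)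
    calc q = 8 / 3 * κ * (3 / 8 * lammin * q) := by linear_combination (-q) * hκ1
      _ ≤ _ := this
  have h0 : 0 ≤ spNormR H := norm_nonneg _
  have h3 : q ≤ 8 / 3 * κ ^ 2 * spNormR H := by
    refine h2.trans ?_
    gcongr
    nlinarith
  have h4 := pow_le_pow_left₀ hq0 h3 2
  have h5 : (8 / 3 * κ ^ 2 * spNormR H) ^ 2 = (64 * κ ^ 4 / 9) * spNormR H ^ 2 := by ring
  rw [h5] at h4
  linarith
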